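/- Let δ₁, δ₂ ∈ F^×. Then: (i) there exists g ∈ G with g·X_{δ₁}·g^{-1} = X_{δ₂} if and only if δ₂·δ₁^{-1} ∈ { x·σ(x) : x ∈ E^× }; (ii) there exists g ∈ K with g·X_{δ₁}·g^{-1} = X_{δ₂} if and only if ν(δ₁) = ν(δ₂). -/

import Mathlib

open Matrix

noncomputable section

/-- A 2×2 matrix over `E`. -/
abbrev Mat (E : Type) := Matrix (Fin 2) (Fin 2) E

/-- The context: `E/F` is the unramified quadratic extension of a finite extension `F` of
`ℚ_p` (`p` odd), encoded via the Galois involution `sig` (whose fixed field is `F`),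
the valuation `nu` (normalized by `nu ϖ = 1` for a uniformizer `ϖ` of `F`),
a square root `sqeps` of a non-square unit `eps = sqeps^2` of `O_F`, the residue-field
cardinality `q` of `F`, and an additive character `psi'` of `F` trivial on `p_F` and
nontrivial on `O_F`. -/
structure USetting (E : Type) [Field E] where
  sig : E →+* E
  nu : E → WithTop ℤ
  sqeps : E
  pi : E
  q : ℕ
  psi' : E → ℂ
  sig_invol : ∀ x, sig (sig x) = x
  sig_ne : ∃ x, sig x ≠ x
  nu_eq_top : ∀ x, nu x = ⊤ ↔ x = 0
  nu_mul : ∀ x y, nu (x * y) = nu x + nu y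
  nu_add : ∀ x y, min (nu x) (nu y) ≤ nu (x + y)
  nu_sig : ∀ x, nu (sig x) = nu x
  nu_pi : nu pi = 1
  sig_pi : sig pi = pi
  sig_sqeps : sig sqeps = - sqeps
  nu_sqeps : nu sqeps = 0
  eps_not_square : ∀ y, sig y = y → y * y ≠ sqeps * sqeps
  gen : ∀ x : E, ∃ a b, sig a = a ∧ sig b = b ∧ x = a + b * sqeps
  nu_two : nu 2 = 0
  charzero : ∀ n : ℕ, (n : E) = 0 → n = 0
  complete : ∀ f : ℕ → E, (∀ n : ℕ, ((n : ℤ) : WithTop ℤ) ≤ nu (f (n + 1) - f n)) →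
    ∃ L, ∀ n : ℕ, ((n : ℤ) : WithTop ℤ) ≤ nu (L - f n)
  res_card : ∃ R : Finset E, R.card = q ∧ (∀ x ∈ R, sig x = x ∧ 0 ≤ nu x) ∧
    ∀ y : E, sig y = y → 0 ≤ nu y → ∃! x, x ∈ R ∧ 1 ≤ nu (y - x)
  psi'_mul : ∀ x y, sig x = x → sig y = y → psi' (x + y) = psi' x * psi' y
  psi'_ne : ∀ x, sig x = x → psi' x ≠ 0
  psi'_triv : ∀ x, sig x = x → 1 ≤ nu x → psi' x = 1
  psi'_nontriv : ∃ x, sig x = x ∧ 0 ≤ nu x ∧ psi' x ≠ 1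

variable {E : Type} [Field E]

/-- The matrix `w₀ = [[0,1],[1,0]]`. -/
def w0 (E : Type) [Field E] : Mat E := !![0, 1; 1, 0]

/-- `G = U(1,1)(F)`. -/
def Gset (S : USetting E) : Set (Mat E) :=
  {g | (g.map ⇑S.sig)ᵀ * w0 E * g = w0 E}

/-- `K = G ∩ GL₂(O_E)`: entries in `O_E` and determinant in `O_E^×`. -/
def Kset (S : USetting E) : Set (Mat E) :=
  {g | g ∈ Gset S ∧ (∀ i j, 0 ≤ S.nu (g i j)) ∧ S.nu g.det = 0}

/-- The congruence filtration subgroup `K_n` (for `n ≥ 1`; `K_0 = K` as a set). -/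
def Kfil (S : USetting E) (n : ℤ) : Set (Mat E) :=
  {g | g ∈ Kset S ∧ ∀ i j, (n : WithTop ℤ) ≤ S.nu ((g - 1) i j)}

/-- `𝓑 = B ∩ K`, the upper triangular matrices in `K`. -/
def Bcal (S : USetting E) : Set (Mat E) := {g | g ∈ Kset S ∧ g 1 0 = 0}

/-- `E^1`, the norm-one elements of `E`. -/
def E1set (S : USetting E) : Set E := {x | x * S.sig x = 1}

/-- `O_F^×` as a subset of `E`. -/
def OFunits (S : USetting E) : Set E := {x | S.sig x = x ∧ S.nu x = 0}

/-- `O_E^×` as a subset of `E`. -/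
def OEunits (S : USetting E) : Set E := {x | S.nu x = 0}

/-- A character of `E^×`, encoded as a function `E → ℂ` multiplicative and
nonvanishing on nonzero elements. -/
def IsChar (χ : E → ℂ) : Prop :=
  (∀ x y : E, x ≠ 0 → y ≠ 0 → χ (x * y) = χ x * χ y) ∧ ∀ x : E, x ≠ 0 → χ x ≠ 0

/-- A group homomorphism `E^1 → ℂ^×`, encoded as a function `E → ℂ`. -/
def IsE1Hom (S : USetting E) (φ : E → ℂ) : Prop :=
  (∀ x ∈ E1set S, ∀ y ∈ E1set S, φ (x * y) = φ x * φ y) ∧ ∀ x ∈ E1set S, φ x ≠ 0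

/-- A homomorphism into `ℂ^×` on a subset of matrices. -/
def IsHomOn (A : Set (Mat E)) (Ψ : Mat E → ℂ) : Prop :=
  (∀ x ∈ A, ∀ y ∈ A, Ψ (x * y) = Ψ x * Ψ y) ∧ ∀ x ∈ A, Ψ x ≠ 0

/-- `1 + p_E^n`. -/
def onePE (S : USetting E) (n : ℤ) : Set E := {x | (n : WithTop ℤ) ≤ S.nu (x - 1)}

/-- `1 + p_F^n`. -/
def onePF (S : USetting E) (n : ℤ) : Set E :=
  {x | S.sig x = x ∧ (n : WithTop ℤ) ≤ S.nu (x - 1)}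

/-- `χ` is trivial on a set. -/
def TrivOn (χ : E → ℂ) (s : Set E) : Prop := ∀ x ∈ s, χ x = 1

/-- `χ` has depth `r`: trivial on `1+p_E^{r+1}` and (if `r ≥ 1`) nontrivial on `1+p_E^r`. -/
def HasDepth (S : USetting E) (χ : E → ℂ) (r : ℕ) : Prop :=
  TrivOn χ (onePE S ((r : ℤ) + 1)) ∧ (r = 0 ∨ ¬ TrivOn χ (onePE S (r : ℤ)))

/-- `χ` has true depth `r`: the depth of its restriction to `F^×` is `r`. -/
def HasTrueDepth (S : USetting E) (χ : E → ℂ) (r : ℕ) : Prop :=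
  TrivOn χ (onePF S ((r : ℤ) + 1)) ∧ (r = 0 ∨ ¬ TrivOn χ (onePF S (r : ℤ)))

/-- `χ` has minimal depth `r`: its depth and true depth both equal `r`. -/
def MinDepth (S : USetting E) (χ : E → ℂ) (r : ℕ) : Prop :=
  HasDepth S χ r ∧ HasTrueDepth S χ r

/-- Right translation action on functions. -/
def rho (g : Mat E) : (Mat E → ℂ) →ₗ[ℂ] (Mat E → ℂ) where
  toFun f := fun k => f (k * g)
  map_add' _ _ := rfl
  map_smul' _ _ := rfl

/-- The space `V_χ^{K_n}`: functions on `K` (extended by zero off `K`) satisfying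
`f(bk) = χ(b₁₁) f(k)` for `b ∈ 𝓑` and right `K_n`-invariance. -/
def Vsp (S : USetting E) (χ : E → ℂ) (n : ℤ) : Submodule ℂ (Mat E → ℂ) where
  carrier := {f | (∀ x, x ∉ Kset S → f x = 0) ∧
    (∀ b ∈ Bcal S, ∀ k ∈ Kset S, f (b * k) = χ (b 0 0) * f k) ∧
    (∀ k ∈ Kset S, ∀ g ∈ Kfil S n, f (k * g) = f k)}
  add_mem' := by
    rintro f g ⟨hf0, hf1, hf2⟩ ⟨hg0, hg1, hg2⟩
    refine ⟨fun x hx => ?_, fun b hb k hk => ?_, fun k hk g' hg' => ?_⟩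
    · simp [hf0 x hx, hg0 x hx]
    · simp only [Pi.add_apply, hf1 b hb k hk, hg1 b hb k hk]; ring
    · simp only [Pi.add_apply, hf2 k hk g' hg', hg2 k hk g' hg']
  zero_mem' := by
    refine ⟨fun x _ => rfl, fun b _ k _ => by simp, fun k _ g _ => rfl⟩
  smul_mem' := by
    rintro c f ⟨hf0, hf1, hf2⟩
    refine ⟨fun x hx => ?_, fun b hb k hk => ?_, fun k hk g' hg' => ?_⟩
    · simp [hf0 x hx]
    · simp only [Pi.smul_apply, hf1 b hb k hk, smul_eq_mul]; ring
    · simp only [Pi.smul_apply, hf2 k hk g' hg']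

/-- The space of the representation induced from a character `Ψ` of a subgroup `H ⊆ K`:
functions on `K` (extended by zero) with `f(hk) = Ψ(h) f(k)`. -/
def IndSp (S : USetting E) (H : Set (Mat E)) (Ψ : Mat E → ℂ) : Submodule ℂ (Mat E → ℂ) where
  carrier := {f | (∀ x, x ∉ Kset S → f x = 0) ∧
    ∀ h ∈ H, ∀ k ∈ Kset S, f (h * k) = Ψ h * f k}
  add_mem' := by
    rintro f g ⟨hf0, hf1⟩ ⟨hg0, hg1⟩
    refine ⟨fun x hx => ?_, fun h hh k hk => ?_⟩
    · simp [hf0 x hx, hg0 x hx]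
    · simp only [Pi.add_apply, hf1 h hh k hk, hg1 h hh k hk]; ring
  zero_mem' := ⟨fun x _ => rfl, fun h _ k _ => by simp⟩
  smul_mem' := by
    rintro c f ⟨hf0, hf1⟩
    refine ⟨fun x hx => ?_, fun h hh k hk => ?_⟩
    · simp [hf0 x hx]
    · simp only [Pi.smul_apply, hf1 h hh k hk, smul_eq_mul]; ring

/-- The functions constant on `K` and zero off `K`. -/
def ConstSub (S : USetting E) : Submodule ℂ (Mat E → ℂ) where
  carrier := {f | (∀ x, x ∉ Kset S → f x = 0) ∧ ∃ c : ℂ, ∀ k ∈ Kset S, f k = c}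
  add_mem' := by
    rintro f g ⟨hf0, c, hc⟩ ⟨hg0, c', hc'⟩
    exact ⟨fun x hx => by simp [hf0 x hx, hg0 x hx],
      c + c', fun k hk => by simp [hc k hk, hc' k hk]⟩
  zero_mem' := ⟨fun x _ => rfl, 0, fun _ _ => rfl⟩
  smul_mem' := by
    rintro a f ⟨hf0, c, hc⟩
    exact ⟨fun x hx => by simp [hf0 x hx], a * c, fun k hk => by simp [hc k hk]⟩

/-- A subspace is `K`-invariant. -/
def KInvariant (S : USetting E) (W : Submodule ℂ (Mat E → ℂ)) : Prop :=
  ∀ g ∈ Kset S, ∀ f ∈ W, rho g f ∈ W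

/-- A subset `A ⊆ K` acts trivially on `W`. -/
def ActsTrivially (S : USetting E) (A : Set (Mat E)) (W : Submodule ℂ (Mat E → ℂ)) : Prop :=
  ∀ g ∈ A, ∀ f ∈ W, rho g f = f

/-- `W` is an irreducible representation of `K`. -/
def IsIrredRep (S : USetting E) (W : Submodule ℂ (Mat E → ℂ)) : Prop :=
  W ≠ ⊥ ∧ KInvariant S W ∧
    ∀ U : Submodule ℂ (Mat E → ℂ), U ≤ W → KInvariant S U → U = ⊥ ∨ U = W

/-- `V` and `W` are isomorphic as representations of `K`. -/
def RepIso (S : USetting E) (V W : Submodule ℂ (Mat E → ℂ)) : Prop :=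
  ∃ e : (Mat E → ℂ) →ₗ[ℂ] (Mat E → ℂ), Set.BijOn ⇑e ↑V ↑W ∧
    ∀ g ∈ Kset S, ∀ f ∈ V, e (rho g f) = rho g (e f)

/-- The space of `ℂ`-linear endomorphisms of `V` commuting with the right-translation
action of `K`, realized inside the function space `↥V → ↥V`. -/
def Commutant (S : USetting E) (V : Submodule ℂ (Mat E → ℂ)) :
    Submodule ℂ (↥V → ↥V) where
  carrier := {T | (∀ x y : ↥V, T (x + y) = T x + T y) ∧
    (∀ (c : ℂ) (x : ↥V), T (c • x) = c • T x) ∧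
    ∀ g ∈ Kset S, ∀ f : ↥V, ∀ h : rho g (f : Mat E → ℂ) ∈ V,
      ((T ⟨rho g (f : Mat E → ℂ), h⟩ : ↥V) : Mat E → ℂ) = rho g ((T f : ↥V) : Mat E → ℂ)}
  add_mem' := by
    rintro T T' ⟨hT1, hT2, hT3⟩ ⟨hT1', hT2', hT3'⟩
    refine ⟨fun x y => ?_, fun c x => ?_, fun g hg f h => ?_⟩
    · simp only [Pi.add_apply, hT1 x y, hT1' x y]; abel
    · simp only [Pi.add_apply, hT2 c x, hT2' c x, smul_add]
    · simp only [Pi.add_apply, Submodule.coe_add, hT3 g hg f h, hT3' g hg f h, map_add]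
  zero_mem' := by
    refine ⟨fun x y => by simp, fun c x => by simp, fun g hg f h => by simp⟩
  smul_mem' := by
    rintro c T ⟨hT1, hT2, hT3⟩
    refine ⟨fun x y => ?_, fun a x => ?_, fun g hg f h => ?_⟩
    · simp only [Pi.smul_apply, hT1 x y, smul_add]
    · simp only [Pi.smul_apply, hT2 a x, smul_comm c a]
    · simp only [Pi.smul_apply, Submodule.coe_smul, hT3 g hg f h, _root_.map_smul]

/-- The additive character `ψ` of `E`, `ψ(x) = ψ'((x + σ(x))/2)`. -/
def psiE (S : USetting E) (x : E) : ℂ := S.psi' ((x + S.sig x) / 2)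

/-- `Ψ_Y(g) = ψ(Tr(Y (g − 1)))`. -/
def PsiC (S : USetting E) (Y g : Mat E) : ℂ := psiE S ((Y * (g - 1)).trace)

/-- The Lie algebra `𝔤 = 𝔲(1,1)(F)`. -/
def gfrak (S : USetting E) : Set (Mat E) :=
  {Y | (Y.map ⇑S.sig)ᵀ * w0 E + w0 E * Y = 0}

/-- The lattice `𝔨_s` of the Lie algebra, where `c = ⌈s⌉`. -/
def kfrakC (S : USetting E) (c : ℤ) : Set (Mat E) :=
  {Y | Y ∈ gfrak S ∧ (c : WithTop ℤ) ≤ S.nu (Y 0 0) ∧ (c : WithTop ℤ) ≤ S.nu (Y 1 1) ∧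
    (∃ t, S.sig t = t ∧ (c : WithTop ℤ) ≤ S.nu t ∧ Y 0 1 = S.sqeps * t) ∧
    (∃ t, S.sig t = t ∧ (c : WithTop ℤ) ≤ S.nu t ∧ Y 1 0 = S.sqeps * t)}

/-- The group `J_d`. -/
def Jgrp (S : USetting E) (d : ℕ) : Set (Mat E) :=
  {g | g ∈ Kset S ∧ ((((d + 1) / 2 : ℕ) : WithTop ℤ) ≤ S.nu (g 0 0 - 1)) ∧
    ((((d + 1) / 2 : ℕ) : WithTop ℤ) ≤ S.nu (g 0 1)) ∧
    ((((d + 1) / 2 : ℕ) : WithTop ℤ) ≤ S.nu (g 1 1 - 1)) ∧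
    (((d / 2 + 1 : ℕ) : WithTop ℤ) ≤ S.nu (g 1 0))}

/-- The centralizer `T(X)` in `K` of `X = [[z√ε, u√ε],[v√ε, z√ε]]`. -/
def TXset (S : USetting E) (u v : E) : Set (Mat E) :=
  {m | m ∈ Kset S ∧ m 1 1 = m 0 0 ∧ m 1 0 = m 0 1 * (u⁻¹ * v)}

/-- The center `Z` of `G`, identified with scalar matrices with entries in `E^1`. -/
def Zset (S : USetting E) : Set (Mat E) := {m | ∃ z ∈ E1set S, m = z • (1 : Mat E)}

/-- `𝒰 = U ∩ K`. -/
def Uset (S : USetting E) : Set (Mat E) :=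
  {m | ∃ b, S.sig b = b ∧ 0 ≤ S.nu b ∧ m = !![1, b * S.sqeps; 0, 1]}

/-- The set of products `T(X)·J_d`. -/
def TXJ (S : USetting E) (u v : E) (d : ℕ) : Set (Mat E) :=
  {x | ∃ t ∈ TXset S u v, ∃ j ∈ Jgrp S d, x = t * j}

/-- The set of products `Z·𝒰·J_d`. -/
def ZUJ (S : USetting E) (d : ℕ) : Set (Mat E) :=
  {x | ∃ z ∈ Zset S, ∃ m ∈ Uset S, ∃ j ∈ Jgrp S d, x = z * m * j}

/-- `X = [[z√ε, u√ε],[v√ε, z√ε]]`. -/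
def Xzuv (S : USetting E) (z u v : E) : Mat E :=
  !![z * S.sqeps, u * S.sqeps; v * S.sqeps, z * S.sqeps]

/-- The nilpotent element `X_δ = [[0, δ√ε],[0,0]]`. -/
def Xdelta (S : USetting E) (δ : E) : Mat E := !![0, δ * S.sqeps; 0, 0]

/-- `W` is a `K`-invariant complement of `V_χ^{K_d}` inside `V_χ^{K_{d+1}}`. -/
def Wcompl (S : USetting E) (χ : E → ℂ) (d : ℕ) (W : Submodule ℂ (Mat E → ℂ)) : Prop :=
  W ≤ Vsp S χ ((d : ℤ) + 1) ∧ KInvariant S W ∧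
    Vsp S χ (d : ℤ) ⊓ W = ⊥ ∧ Vsp S χ (d : ℤ) ⊔ W = Vsp S χ ((d : ℤ) + 1)

open Polynomial in
/-- Over a finite field of odd characteristic, a binary diagonal quadratic form represents
every element. -/
lemma FiniteField.exists_mul_self_sub_mul_mul_self_eq {k : Type*} [Field k] [Finite k]
    (h2 : (2 : k) ≠ 0) {e : k} (he : e ≠ 0) (u : k) : ∃ a b : k, a * a - e * (b * b) = u := by
  have := Fintype.ofFinite k
  have hodd : Fintype.card k % 2 = 1 :=
    FiniteField.odd_card_of_char_ne_two fun h => h2 <| by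
      have := CharP.cast_eq_zero k (ringChar k)
      rw [h] at this
      exact_mod_cast this
  obtain ⟨a, b, hab⟩ := FiniteField.exists_root_sum_quadratic (f := X ^ 2 - C u)
    (g := C (-e) * X ^ 2) (degree_X_pow_sub_C two_pos u)
    (degree_C_mul_X_pow 2 (neg_ne_zero.2 he)) hodd
  refine ⟨a, b, ?_⟩
  simp at hab
  linear_combination hab

namespace USetting

variable (S : USetting E)

lemma nu_zero : S.nu 0 = ⊤ := (S.nu_eq_top 0).2 rfl

lemma nu_ne_top {x : E} (hx : x ≠ 0) : S.nu x ≠ ⊤ := fun h => hx ((S.nu_eq_top x).1 h)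

lemma exists_nu_eq_coe {x : E} (hx : x ≠ 0) : ∃ n : ℤ, S.nu x = n := by
  obtain ⟨n, hn⟩ := WithTop.ne_top_iff_exists.1 (S.nu_ne_top hx)
  exact ⟨n, hn.symm⟩

lemma nu_one : S.nu 1 = 0 := by
  obtain ⟨n, hn⟩ := S.exists_nu_eq_coe (one_ne_zero (α := E))
  have h := S.nu_mul 1 1
  rw [one_mul, hn] at h
  rw [hn]
  norm_cast at h ⊢
  lia

lemma nu_eq_zero_of_mul_self {x : E} (h : S.nu (x * x) = 0) : S.nu x = 0 := by
  have hx : x ≠ 0 := by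
    rintro rfl
    simp [S.nu_zero] at h
  obtain ⟨n, hn⟩ := S.exists_nu_eq_coe hx
  rw [S.nu_mul, hn] at h
  rw [hn]
  norm_cast at h ⊢
  lia

lemma ne_zero_of_nu_eq_zero {x : E} (hx : S.nu x = 0) : x ≠ 0 := by
  rintro rfl
  simp [S.nu_zero] at hx

lemma nu_neg (x : E) : S.nu (-x) = S.nu x := by
  have h : S.nu (-1) = 0 := S.nu_eq_zero_of_mul_self (by rw [neg_mul_neg, one_mul, S.nu_one])
  rw [← neg_one_mul, S.nu_mul, h, zero_add]

lemma nu_sub (x y : E) : min (S.nu x) (S.nu y) ≤ S.nu (x - y) := by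
  have h := S.nu_add x (-y)
  rwa [S.nu_neg, ← sub_eq_add_neg] at h

lemma le_nu_add {c : WithTop ℤ} {x y : E} (hx : c ≤ S.nu x) (hy : c ≤ S.nu y) :
    c ≤ S.nu (x + y) :=
  (le_min hx hy).trans (S.nu_add x y)

lemma le_nu_sub {c : WithTop ℤ} {x y : E} (hx : c ≤ S.nu x) (hy : c ≤ S.nu y) :
    c ≤ S.nu (x - y) :=
  (le_min hx hy).trans (S.nu_sub x y)

lemma le_nu_mul {c d : WithTop ℤ} {x y : E} (hx : c ≤ S.nu x) (hy : d ≤ S.nu y) :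
    c + d ≤ S.nu (x * y) := by
  rw [S.nu_mul]
  exact add_le_add hx hy

lemma nu_inv_of_nu_eq_zero {x : E} (hx : S.nu x = 0) : S.nu x⁻¹ = 0 := by
  have h := S.nu_mul x x⁻¹
  rw [mul_inv_cancel₀ (S.ne_zero_of_nu_eq_zero hx), S.nu_one, hx, zero_add] at h
  exact h.symm

lemma nu_div_two (x : E) : S.nu (x / 2) = S.nu x := by
  rw [div_eq_mul_inv, S.nu_mul, S.nu_inv_of_nu_eq_zero S.nu_two, add_zero]

lemma eq_zero_of_forall_le_nu {x : E} (h : ∀ n : ℕ, ((n : ℤ) : WithTop ℤ) ≤ S.nu x) :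
    x = 0 := by
  by_contra hx
  obtain ⟨m, hm⟩ := S.exists_nu_eq_coe hx
  have := h (m.toNat + 1)
  rw [hm] at this
  norm_cast at this
  lia

/-- One-units of `F` are squares in `F`. -/
lemma exists_mul_self_eq_of_one_le_nu_sub_one {v : E} (hv : S.sig v = v)
    (hv1 : 1 ≤ S.nu (v - 1)) : ∃ t, S.sig t = t ∧ t * t = v := by
  have h2 := S.ne_zero_of_nu_eq_zero S.nu_two
  -- Solve `(1 + s)² = v` by iterating the contraction `s ↦ (v - 1 - s²) / 2`.
  let φ : E → E := fun s => (v - 1 - s * s) / 2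
  have hφ : ∀ s t, S.nu (φ s - φ t) = S.nu (s - t) + S.nu (s + t) := fun s t => by
    have : φ s - φ t = -((s - t) * (s + t) / 2) := by simp only [φ]; ring
    rw [this, S.nu_neg, S.nu_div_two, S.nu_mul]
  let f : ℕ → E := fun n => φ^[n] 0
  have hf0 : f 0 = 0 := rfl
  have hf : ∀ n, f (n + 1) = φ (f n) := fun n => Function.iterate_succ_apply' φ n 0
  have hf1 : ∀ n, 1 ≤ S.nu (f n) := fun n => by
    induction n with
    | zero => simp [hf0, S.nu_zero]
    | succ n ih =>
      rw [hf, S.nu_div_two]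
      refine S.le_nu_sub hv1 (le_trans ?_ (S.le_nu_mul ih ih))
      norm_num
  have hsig : ∀ n, S.sig (f n) = f n := fun n => by
    induction n with
    | zero => simp [hf0]
    | succ n ih => rw [hf]; simp only [φ, map_div₀, map_sub, map_mul, map_one, map_ofNat, ih, hv]
  have hstep : ∀ n : ℕ, ((n : ℤ) : WithTop ℤ) ≤ S.nu (f (n + 1) - f n) := fun n => by
    induction n with
    | zero => simpa [hf0] using zero_le_one.trans (hf1 1)
    | succ n ih =>
      rw [hf (n + 1), hf n, hφ, ← hf n]
      push_cast
      exact add_le_add ih (S.le_nu_add (hf1 _) (hf1 _))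
  obtain ⟨L, hL⟩ := S.complete f hstep
  have hL0 : 0 ≤ S.nu L := by simpa [hf0] using hL 0
  have hfix : L - φ L = 0 := S.eq_zero_of_forall_le_nu fun n => by
    have h1 : L - φ L = (L - f (n + 1)) - (φ L - φ (f n)) := by rw [hf]; ring
    rw [h1]
    refine S.le_nu_sub (le_trans ?_ (hL (n + 1))) ?_
    · norm_cast; lia
    · rw [hφ]
      simpa using add_le_add (hL n) (S.le_nu_add hL0 (zero_le_one.trans (hf1 n)))
  have hsigL : S.sig L - L = 0 := S.eq_zero_of_forall_le_nu fun n => by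
    have h1 : S.sig L - L = S.sig (L - f n) - (L - f n) := by rw [map_sub, hsig]; ring
    rw [h1]
    exact S.le_nu_sub (by rw [S.nu_sig]; exact hL n) (hL n)
  refine ⟨1 + L, by rw [map_add, map_one, sub_eq_zero.1 hsigL], ?_⟩
  have h3 : 2 * (L - φ L) = 2 * L - (v - 1 - L * L) := by simp only [φ]; field_simp
  rw [hfix] at h3
  linear_combination -h3

/-- The ring of integers `O_F`. -/
def integersF : Subring E where
  carrier := {x | S.sig x = x ∧ 0 ≤ S.nu x}
  mul_mem' := fun ⟨hx, hx'⟩ ⟨hy, hy'⟩ =>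
    ⟨by rw [map_mul, hx, hy], by simpa using S.le_nu_mul hx' hy'⟩
  one_mem' := ⟨map_one _, S.nu_one.ge⟩
  add_mem' := fun ⟨hx, hx'⟩ ⟨hy, hy'⟩ => ⟨by rw [map_add, hx, hy], S.le_nu_add hx' hy'⟩
  zero_mem' := ⟨map_zero _, by simp [S.nu_zero]⟩
  neg_mem' := fun ⟨hx, hx'⟩ => ⟨by rw [map_neg, hx], by rwa [S.nu_neg]⟩

/-- The maximal ideal `p_F` of `O_F`. -/
def maxIdealF : Ideal S.integersF where
  carrier := {x | 1 ≤ S.nu (x : E)}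
  add_mem' := fun hx hy => S.le_nu_add hx hy
  zero_mem' := by simp [S.nu_zero]
  smul_mem' := fun c x hx => by simpa using S.le_nu_mul c.2.2 hx

lemma mem_maxIdealF {x : S.integersF} : x ∈ S.maxIdealF ↔ 1 ≤ S.nu (x : E) := Iff.rfl

lemma nu_eq_zero_of_notMem_maxIdealF {x : S.integersF} (hx : x ∉ S.maxIdealF) :
    S.nu (x : E) = 0 := by
  rw [mem_maxIdealF, not_le] at hx
  have h0 := x.2.2
  obtain ⟨n, hn⟩ := WithTop.ne_top_iff_exists.1 hx.ne_top
  rw [← hn] at hx h0 ⊢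
  norm_cast at hx h0 ⊢
  lia

instance isMaximal_maxIdealF : S.maxIdealF.IsMaximal := by
  refine Ideal.isMaximal_iff.2 ⟨?_, fun J x _ hx hxJ => ?_⟩
  · simp [mem_maxIdealF, S.nu_one]
  · have h0 := S.nu_eq_zero_of_notMem_maxIdealF hx
    let y : S.integersF :=
      ⟨(x : E)⁻¹, by rw [map_inv₀, x.2.1], (S.nu_inv_of_nu_eq_zero h0).ge⟩
    have hyx : y * x = 1 := Subtype.ext (inv_mul_cancel₀ (S.ne_zero_of_nu_eq_zero h0))
    rw [← hyx]
    exact J.mul_mem_left y hxJ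

instance finite_residueFieldF : Finite (S.integersF ⧸ S.maxIdealF) := by
  obtain ⟨R, -, hR, hcover⟩ := S.res_card
  refine Finite.of_surjective
    (fun r : R => Ideal.Quotient.mk S.maxIdealF ⟨r, hR r r.2⟩) fun k => ?_
  obtain ⟨y, rfl⟩ := Ideal.Quotient.mk_surjective k
  obtain ⟨r, ⟨hr, hyr⟩, -⟩ := hcover y y.2.1 y.2.2
  refine ⟨⟨r, hr⟩, (Ideal.Quotient.eq.2 ?_).symm⟩
  exact hyr

/-- Every unit of `O_F` is the norm of an element of `E`. -/
lemma exists_mul_sig_eq_of_nu_eq_zero {u : E} (hu : S.sig u = u) (hu0 : S.nu u = 0) :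
    ∃ x, x * S.sig x = u := by
  let := Ideal.Quotient.field S.maxIdealF
  let π := Ideal.Quotient.mk S.maxIdealF
  have hπ : ∀ x : S.integersF, S.nu (x : E) = 0 → π x ≠ 0 := fun x hx h => by
    rw [Ideal.Quotient.eq_zero_iff_mem, mem_maxIdealF, hx] at h
    exact absurd h (by norm_num)
  let e : S.integersF := ⟨S.sqeps * S.sqeps, by rw [map_mul, S.sig_sqeps, neg_mul_neg],
    by rw [S.nu_mul, S.nu_sqeps, add_zero]⟩
  have he : S.nu (e : E) = 0 := by simp only [e, S.nu_mul, S.nu_sqeps, add_zero]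
  obtain ⟨a, b, hab⟩ := FiniteField.exists_mul_self_sub_mul_mul_self_eq
    (hπ 2 S.nu_two) (hπ e he) (π ⟨u, hu, hu0.ge⟩)
  obtain ⟨a, rfl⟩ := Ideal.Quotient.mk_surjective a
  obtain ⟨b, rfl⟩ := Ideal.Quotient.mk_surjective b
  simp only [π, ← map_mul, ← map_sub] at hab
  have hcong : 1 ≤ S.nu ((a : E) * a - S.sqeps * S.sqeps * (b * b) - u) :=
    S.mem_maxIdealF.1 (Ideal.Quotient.eq.1 hab)
  set y : E := a + b * S.sqeps with hy
  have hsy : S.sig y = a - b * S.sqeps := by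
    rw [hy, map_add, map_mul, a.2.1, b.2.1, S.sig_sqeps]
    ring
  set w : E := y * S.sig y with hw
  have hwu : 1 ≤ S.nu (u - w) := by
    have : u - w = -((a : E) * a - S.sqeps * S.sqeps * (b * b) - u) := by
      rw [hw, hsy, hy]; ring
    rwa [this, S.nu_neg]
  have hw_sig : S.sig w = w := by rw [hw, map_mul, S.sig_invol, mul_comm]
  have hw0 : S.nu w = 0 := by
    have hmem : 0 ≤ S.nu w := by
      have := S.le_nu_sub hu0.ge (zero_le_one.trans hwu)
      rwa [sub_sub_cancel] at this
    refine S.nu_eq_zero_of_notMem_maxIdealF (x := ⟨w, hw_sig, hmem⟩) fun h => ?_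
    have := S.le_nu_add hwu (S.mem_maxIdealF.1 h)
    rw [sub_add_cancel, hu0] at this
    exact absurd this (by norm_num)
  have hw_ne : w ≠ 0 := S.ne_zero_of_nu_eq_zero hw0
  obtain ⟨t, ht, htt⟩ := S.exists_mul_self_eq_of_one_le_nu_sub_one (v := u / w)
    (by rw [map_div₀, hu, hw_sig]) (by
      have : u / w - 1 = (u - w) * w⁻¹ := by field_simp
      rwa [this, S.nu_mul, S.nu_inv_of_nu_eq_zero hw0, add_zero])
  refine ⟨y * t, ?_⟩
  calc y * t * S.sig (y * t) = w * (t * t) := by rw [map_mul, ht, hw]; ring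
    _ = u := by rw [htt, mul_div_cancel₀ _ hw_ne]

end USetting

lemma det_ne_zero_of_mem_Gset {S : USetting E} {g : Mat E} (hg : g ∈ Gset S) : g.det ≠ 0 := by
  intro h
  have := congrArg Matrix.det (show (g.map ⇑S.sig)ᵀ * w0 E * g = w0 E from hg)
  rw [Matrix.det_mul, h, mul_zero] at this
  simp [w0, Matrix.det_fin_two] at this

/-- An element of `G` conjugating `X_{δ₁}` to `X_{δ₂}` is upper triangular, with diagonal
`(x, σ(x)⁻¹)` for some `x` of norm `δ₂ δ₁⁻¹`. -/
lemma entries_of_conj_Xdelta {S : USetting E} {δ₁ δ₂ : E} (h2 : δ₂ ≠ 0)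
    {g : Mat E} (hg : g ∈ Gset S) (h : g * Xdelta S δ₁ * g⁻¹ = Xdelta S δ₂) :
    S.sig (g 0 0) * g 1 1 = 1 ∧ g 0 0 * δ₁ = g 1 1 * δ₂ ∧ g 1 0 = 0 := by
  have hs : S.sqeps ≠ 0 := S.ne_zero_of_nu_eq_zero S.nu_sqeps
  have hcomm : g * Xdelta S δ₁ = Xdelta S δ₂ * g := by
    rw [← h, Matrix.nonsing_inv_mul_cancel_right _ _ (det_ne_zero_of_mem_Gset hg).isUnit]
  have hc : g 1 0 = 0 := by
    have := congrFun (congrFun hcomm 0) 0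
    simpa [Xdelta, Matrix.mul_apply, Fin.sum_univ_two, h2, hs] using this
  have had : g 0 0 * δ₁ = g 1 1 * δ₂ := by
    have := congrFun (congrFun hcomm 0) 1
    simp only [Xdelta, Matrix.mul_apply, Fin.sum_univ_two] at this
    simp at this
    refine mul_right_cancel₀ hs ?_
    linear_combination this
  refine ⟨?_, had, hc⟩
  have := congrFun (congrFun (show (g.map ⇑S.sig)ᵀ * w0 E * g = w0 E from hg) 0) 1
  simpa [w0, Matrix.mul_apply, Fin.sum_univ_two, hc] using this

lemma diagonal_mem_Gset (S : USetting E) {x : E} (hx : x ≠ 0) :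
    !![x, 0; 0, (S.sig x)⁻¹] ∈ Gset S := by
  have hsx : S.sig x ≠ 0 := (map_ne_zero S.sig).2 hx
  show _ = _
  ext i j
  fin_cases i <;> fin_cases j <;>
    simp [w0, Matrix.mul_apply, Fin.sum_univ_two, S.sig_invol, hx, hsx]

lemma diagonal_conj_Xdelta (S : USetting E) {δ₁ δ₂ x : E} (h1 : δ₁ ≠ 0) (hx : x ≠ 0)
    (h : δ₂ * δ₁⁻¹ = x * S.sig x) :
    !![x, 0; 0, (S.sig x)⁻¹] * Xdelta S δ₁ * !![x, 0; 0, (S.sig x)⁻¹]⁻¹ = Xdelta S δ₂ := by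
  have hsx : S.sig x ≠ 0 := (map_ne_zero S.sig).2 hx
  have hδ : δ₂ = x * S.sig x * δ₁ := by rw [← h, inv_mul_cancel_right₀ h1]
  have hcomm : !![x, 0; 0, (S.sig x)⁻¹] * Xdelta S δ₁
      = Xdelta S δ₂ * !![x, 0; 0, (S.sig x)⁻¹] := by
    simp only [Xdelta, hδ, Matrix.mul_fin_two]
    ext i j
    fin_cases i <;> fin_cases j <;> simp
    field_simp
  rw [hcomm, Matrix.mul_nonsing_inv_cancel_right _ _
    (det_ne_zero_of_mem_Gset (diagonal_mem_Gset S hx)).isUnit]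

/-- `X_{δ₁}` and `X_{δ₂}` are `G`-conjugate iff `δ₂ δ₁⁻¹` is a norm from
`E^×`, and `K`-conjugate iff `ν(δ₁) = ν(δ₂)`. -/
theorem stmt16 (S : USetting E) (δ₁ δ₂ : E)
    (h1f : S.sig δ₁ = δ₁) (h2f : S.sig δ₂ = δ₂) (h1 : δ₁ ≠ 0) (h2 : δ₂ ≠ 0) :
    ((∃ g ∈ Gset S, g * Xdelta S δ₁ * g⁻¹ = Xdelta S δ₂) ↔
      ∃ x : E, x ≠ 0 ∧ δ₂ * δ₁⁻¹ = x * S.sig x) ∧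
    ((∃ g ∈ Kset S, g * Xdelta S δ₁ * g⁻¹ = Xdelta S δ₂) ↔ S.nu δ₁ = S.nu δ₂) := by
  refine ⟨⟨?_, ?_⟩, ⟨?_, ?_⟩⟩
  · rintro ⟨g, hg, h⟩
    obtain ⟨hd, had, -⟩ := entries_of_conj_Xdelta h2 hg h
    refine ⟨g 0 0, fun h0 => by simp [h0] at hd, ?_⟩
    rw [← div_eq_mul_inv, div_eq_iff h1]
    linear_combination -S.sig (g 0 0) * had - δ₂ * hd
  · rintro ⟨x, hx, h⟩
    exact ⟨_, diagonal_mem_Gset S hx, diagonal_conj_Xdelta S h1 hx h⟩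
  · rintro ⟨g, ⟨hg, hint, -⟩, h⟩
    obtain ⟨hd, had, -⟩ := entries_of_conj_Xdelta h2 hg h
    have hdiag : S.nu (g 0 0) = 0 ∧ S.nu (g 1 1) = 0 := by
      have hsum := congrArg S.nu hd
      rw [S.nu_mul, S.nu_sig, S.nu_one] at hsum
      exact (add_eq_zero_iff_of_nonneg (hint 0 0) (hint 1 1)).1 hsum
    have := congrArg S.nu had
    rwa [S.nu_mul, S.nu_mul, hdiag.1, hdiag.2, zero_add, zero_add] at this
  · intro h
    have hu0 : S.nu (δ₂ * δ₁⁻¹) = 0 := by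
      rw [S.nu_mul, ← h, ← S.nu_mul, mul_inv_cancel₀ h1, S.nu_one]
    obtain ⟨x, hxu⟩ := S.exists_mul_sig_eq_of_nu_eq_zero (u := δ₂ * δ₁⁻¹)
      (by rw [map_mul, map_inv₀, h1f, h2f]) hu0
    have hx0 : S.nu x = 0 := by
      refine S.nu_eq_zero_of_mul_self ?_
      rw [← hu0, ← hxu, S.nu_mul, S.nu_mul, S.nu_sig]
    have hx : x ≠ 0 := S.ne_zero_of_nu_eq_zero hx0
    have hinv : S.nu (S.sig x)⁻¹ = 0 := S.nu_inv_of_nu_eq_zero (by rw [S.nu_sig, hx0])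
    refine ⟨_, ⟨diagonal_mem_Gset S hx, fun i j => ?_, ?_⟩,
      diagonal_conj_Xdelta S h1 hx hxu.symm⟩
    · fin_cases i <;> fin_cases j <;> simp [hx0, hinv, S.nu_zero]
    · simp [Matrix.det_fin_two, S.nu_mul, hx0, hinv]
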